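/- Let M, D ∈ ℕ with D ≥ 2 and D² ≤ M, let A = {0, 1, …, D−1}, and let α ∈ ℚ with 1 ≤ α < M. Suppose b/q ∈ ℚ is an irreducible fraction with 0 < q ≤ D and |α/M − b/q| ≤ 1/(q·D). Then G ≤ 12·(D/M)·(D/q + log q), where G = (D/M)·sup_{x∈ℝ} Σ_{j=0}^{D−1} sup{ |F_1(t)| : t ∈ x + α·j/M + [0, α·D/M²] } and F_1(x) = D^{−1} Σ_{j=0}^{D−1} e^{−2πi·j·x}. -/

import Mathlib

open scoped Classical

noncomputable section

/-- `e^{-2πi x}` -/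
def ec (x : ℝ) : ℂ := Complex.exp (-(2 * Real.pi * x) * Complex.I)

/-- The normalized exponential sum `F_1(x) = |A|⁻¹ Σ_{a ∈ A} e^{-2πi a x}`. -/
def F1 (A : Finset ℕ) (x : ℝ) : ℂ := (A.card : ℂ)⁻¹ * ∑ a ∈ A, ec ((a : ℝ) * x)

/-- `G = (|A|/M) sup_{x ∈ ℝ} Σ_{a ∈ A} sup { |F_1(t)| : t ∈ x + αa/M + [0, α(max A + 1)/M²] }`. -/
def Gquant (M : ℕ) (A : Finset ℕ) (α : ℚ) : ℝ :=
  ((A.card : ℝ) / (M : ℝ)) *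
    sSup (Set.range fun x : ℝ => ∑ a ∈ A,
      sSup ((fun t => ‖F1 A t‖) ''
        Set.Icc (x + (α : ℝ) * (a : ℝ) / (M : ℝ))
          (x + (α : ℝ) * (a : ℝ) / (M : ℝ) + (α : ℝ) * ((A.sup id : ℕ) + 1) / (M : ℝ) ^ 2)))

theorem aux_ec_add_int (a : ℕ) (t : ℝ) (n : ℤ) : ec ((a : ℝ) * (t + n)) = ec ((a : ℝ) * t) := by
  unfold ec
  rw [Complex.exp_eq_exp_iff_exists_int]
  refine ⟨-(a * n), ?_⟩
  push_cast
  ring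

theorem aux_F1_add_int (A : Finset ℕ) (t : ℝ) (n : ℤ) : F1 A (t + n) = F1 A t := by
  unfold F1
  simp only [aux_ec_add_int]

theorem aux_ec_norm (x : ℝ) : ‖ec x‖ = 1 := by
  unfold ec
  have := Complex.norm_exp_ofReal_mul_I (-(2 * Real.pi * x))
  push_cast at this
  exact this

theorem aux_F1_le_one (A : Finset ℕ) (t : ℝ) : ‖F1 A t‖ ≤ 1 := by
  unfold F1
  rw [norm_mul, norm_inv]
  have h : ‖∑ a ∈ A, ec ((a : ℝ) * t)‖ ≤ A.card := by
    refine (norm_sum_le _ _).trans ?_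
    simp [aux_ec_norm]
  simp only [Complex.norm_natCast]
  rw [inv_mul_eq_div]
  exact div_le_one_of_le₀ h (by positivity)

theorem aux_ec_pow (a : ℕ) (x : ℝ) : ec ((a : ℝ) * x) = ec x ^ a := by
  unfold ec
  rw [← Complex.exp_nat_mul]
  congr 1
  push_cast
  ring

theorem aux_ec_sub_one (x : ℝ) : ‖ec x - 1‖ = 2 * |Real.sin (Real.pi * x)| := by
  have h := Complex.norm_exp_I_mul_ofReal_sub_one (-(2 * Real.pi * x))
  have e : ec x = Complex.exp (Complex.I * ((-(2 * Real.pi * x) : ℝ) : ℂ)) := by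
    unfold ec
    congr 1
    push_cast
    ring
  rw [e, h, norm_mul]
  have : -(2 * Real.pi * x) / 2 = -(Real.pi * x) := by ring
  rw [this, Real.sin_neg]
  simp

theorem aux_sin (t u : ℝ) (hu : 0 ≤ u) (h1 : u ≤ t) (h2 : u ≤ 1 - t) :
    2 * u ≤ |Real.sin (Real.pi * t)| := by
  have hpi := Real.pi_pos
  refine le_trans ?_ (le_abs_self _)
  rcases le_total t (1/2) with h | h
  · have := Real.mul_le_sin (x := Real.pi * t) (by nlinarith) (by nlinarith)
    have e : 2 / Real.pi * (Real.pi * t) = 2 * t := by field_simp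
    linarith
  · have := Real.mul_le_sin (x := Real.pi * (1 - t)) (by nlinarith) (by nlinarith)
    have e : 2 / Real.pi * (Real.pi * (1 - t)) = 2 * (1 - t) := by field_simp
    have e2 : Real.sin (Real.pi * (1 - t)) = Real.sin (Real.pi * t) := by
      rw [← Real.sin_pi_sub]; congr 1; ring
    linarith

theorem aux_F1_le (D : ℕ) (hD : 0 < D) (t u : ℝ) (hu : 0 < u) (h1 : u ≤ t) (h2 : u ≤ 1 - t) :
    ‖F1 (Finset.range D) t‖ ≤ 1 / (2 * D * u) := by
  have hD' : (0:ℝ) < D := by exact_mod_cast hD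
  unfold F1
  simp only [aux_ec_pow, Finset.card_range]
  have hg := geom_sum_mul (ec t) D
  have hn := congrArg norm hg
  rw [norm_mul, aux_ec_sub_one] at hn
  have h3 : ‖ec t ^ D - 1‖ ≤ 2 := by
    refine (norm_sub_le _ _).trans ?_
    rw [norm_pow, aux_ec_norm]
    norm_num
  have hs := aux_sin t u hu.le h1 h2
  rw [norm_mul, norm_inv, Complex.norm_natCast]
  set S := ‖∑ i ∈ Finset.range D, ec t ^ i‖ with hS
  have hS0 : 0 ≤ S := norm_nonneg _
  have : S * (2 * u) ≤ 1 := by nlinarith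
  rw [inv_mul_eq_div, div_le_div_iff₀ hD' (by positivity)]
  nlinarith

def auxf (q D : ℕ) (k : ℕ) : ℝ := if k ≤ 1 then 1 else (q : ℝ) / (2 * D * ((k : ℝ) - 1))

theorem auxf_nonneg (q D k : ℕ) : 0 ≤ auxf q D k := by
  unfold auxf
  split_ifs with h
  · norm_num
  · have : (1:ℝ) ≤ k := by exact_mod_cast (by omega : 1 ≤ k)
    have : (0:ℝ) ≤ (k:ℝ) - 1 := by linarith
    positivity

theorem auxf_sum (q D : ℕ) :
    ∑ k ∈ Finset.range q, auxf q D k ≤ 2 + (q : ℝ) / (2 * D) * (1 + Real.log q) := by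
  have hlq : 0 ≤ Real.log q := Real.log_natCast_nonneg q
  rcases Nat.lt_or_ge q 2 with h | h
  · have h1 : ∑ k ∈ Finset.range q, auxf q D k ≤ 2 := by
      interval_cases q <;> simp [auxf]
    have : 0 ≤ (q : ℝ) / (2 * D) * (1 + Real.log q) := by positivity
    linarith
  · obtain ⟨m, hm⟩ : ∃ m, q = m + 2 := ⟨q - 2, by omega⟩
    have hs : ∑ k ∈ Finset.range q, auxf q D k
        = 2 + (q : ℝ) / (2 * D) * ((harmonic m : ℚ) : ℝ) := by
      have : Finset.range q = Finset.range (m + 1 + 1) := by rw [hm]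
      rw [this, Finset.sum_range_succ', Finset.sum_range_succ']
      have e : ∀ k ∈ Finset.range m, auxf q D (k + 1 + 1)
          = (q : ℝ) / (2 * D) * ((k : ℝ) + 1)⁻¹ := by
        intro k _
        unfold auxf
        rw [if_neg (by omega)]
        push_cast
        have : (k : ℝ) + 1 + 1 - 1 = k + 1 := by ring
        rw [this, ← div_div, div_eq_mul_inv _ ((k : ℝ) + 1)]
      rw [Finset.sum_congr rfl e, ← Finset.mul_sum]
      have e2 : ((harmonic m : ℚ) : ℝ) = ∑ k ∈ Finset.range m, ((k : ℝ) + 1)⁻¹ := by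
        simp [harmonic]
      rw [e2]
      simp [auxf]
      ring
    rw [hs]
    have hh := harmonic_le_one_add_log m
    have hl : Real.log m ≤ Real.log q := by
      rcases Nat.eq_zero_or_pos m with h0 | h0
      · rw [h0]; simpa using hlq
      · apply Real.log_le_log (by exact_mod_cast h0)
        exact_mod_cast (by omega : m ≤ q)
    have : (q : ℝ) / (2 * D) * ((harmonic m : ℚ) : ℝ) ≤ (q : ℝ) / (2 * D) * (1 + Real.log q) := by
      apply mul_le_mul_of_nonneg_left _ (by positivity)
      linarith
    linarith

theorem aux_point (q D : ℕ) (hq : 0 < q) (hqD : q ≤ D) (y p : ℝ) (k : ℕ) (hk : k < q)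
    (hy0 : 0 ≤ y) (hy1 : y ≤ 1 / q) (hp : |p| ≤ 1 / D) :
    ‖F1 (Finset.range D) (y + k / q + p)‖ ≤ auxf q D k + auxf q D (q - 1 - k) := by
  have hD : 0 < D := by omega
  have hD' : (0:ℝ) < D := by exact_mod_cast hD
  have hq' : (0:ℝ) < q := by exact_mod_cast hq
  have n1 := auxf_nonneg q D k
  have n2 := auxf_nonneg q D (q - 1 - k)
  have hone := aux_F1_le_one (Finset.range D) (y + k / q + p)
  by_cases h1 : k ≤ 1
  · have : auxf q D k = 1 := by simp [auxf, h1]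
    linarith
  by_cases h2 : q - 1 - k ≤ 1
  · have : auxf q D (q - 1 - k) = 1 := by simp only [auxf, if_pos h2]
    linarith
  obtain ⟨l, hl⟩ : ∃ l, l = q - 1 - k := ⟨_, rfl⟩
  rw [← hl] at h2 n2 ⊢
  have hlq : (q : ℝ) = k + l + 1 := by exact_mod_cast (by omega : q = k + l + 1)
  have hDq : (1:ℝ) / D ≤ 1 / q := one_div_le_one_div_of_le hq' (by exact_mod_cast hqD)
  have hp' := abs_le.mp (hp.trans hDq)
  have hk2 : (2:ℝ) ≤ k := by exact_mod_cast (by omega : 2 ≤ k)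
  have hl2 : (2:ℝ) ≤ l := by exact_mod_cast (by omega : 2 ≤ l)
  have t1 : ((k:ℝ) - 1) / q ≤ y + k / q + p := by
    have : ((k:ℝ) - 1) / q = k / q - 1 / q := by ring
    linarith [hp'.1]
  have t2 : ((l:ℝ) - 1) / q ≤ 1 - (y + k / q + p) := by
    have : (1:ℝ) = k / q + l / q + 1 / q := by
      rw [← add_div, ← add_div, ← hlq, div_self hq'.ne']
    have : ((l:ℝ) - 1) / q = l / q - 1 / q := by ring
    linarith [hp'.2]
  have e : ∀ j : ℕ, ¬ j ≤ 1 → auxf q D j = 1 / (2 * D * (((j:ℝ) - 1) / q)) := by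
    intro j hj
    have : (2:ℝ) ≤ j := by exact_mod_cast (by omega : 2 ≤ j)
    have : (j:ℝ) - 1 ≠ 0 := by linarith
    simp only [auxf, if_neg hj]
    field_simp
  rcases le_total k l with hkl | hkl
  · have hkl' : (k:ℝ) ≤ l := by exact_mod_cast hkl
    have := aux_F1_le D hD (y + k / q + p) (((k:ℝ) - 1) / q) (div_pos (by linarith) hq') t1
      (le_trans (by gcongr) t2)
    rw [← e k h1] at this
    linarith
  · have hkl' : (l:ℝ) ≤ k := by exact_mod_cast hkl
    have := aux_F1_le D hD (y + k / q + p) (((l:ℝ) - 1) / q) (div_pos (by linarith) hq')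
      (le_trans (by gcongr) t1) t2
    rw [← e l h2] at this
    linarith

def auxh (D : ℕ) (L x : ℝ) : ℝ :=
  sSup ((fun t => ‖F1 (Finset.range D) t‖) '' Set.Icc x (x + L))

theorem auxh_nonneg (D : ℕ) (L x : ℝ) : 0 ≤ auxh D L x := by
  apply Real.sSup_nonneg
  rintro _ ⟨t, _, rfl⟩
  exact norm_nonneg _

theorem aux_block (q D : ℕ) (hq : 0 < q) (hqD : q ≤ D) (b : ℤ) (hbq : Int.gcd b q = 1)
    (β L : ℝ) (hL0 : 0 ≤ L) (hL : L ≤ 1 / D) (hβ : |β - b / q| ≤ 1 / ((q : ℝ) * D)) (x : ℝ) :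
    ∑ r ∈ Finset.range q, auxh D L (x + β * r) ≤ 4 + (q : ℝ) / D * (1 + Real.log q) := by
  have hD : 0 < D := by omega
  have hD' : (0:ℝ) < D := by exact_mod_cast hD
  have hq' : (0:ℝ) < q := by exact_mod_cast hq
  have hqz : (q : ℤ) ≠ 0 := by exact_mod_cast hq.ne'
  obtain ⟨c, hc⟩ : ∃ c : ℝ, ∀ r : ℕ, r < q → ∀ η : ℝ, 0 ≤ η → η ≤ L →
      |(β - b / q) * r + η - c| ≤ 1 / D := by
    have key : ∀ r : ℕ, r < q → |β - b / q| * r ≤ 1 / D := by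
      intro r hr
      have hr' : (r:ℝ) ≤ q := by exact_mod_cast hr.le
      calc |β - b / q| * r ≤ 1 / ((q : ℝ) * D) * q := by gcongr
        _ = 1 / D := by field_simp
    rcases le_total 0 (β - b / q) with h | h
    · refine ⟨1 / D, fun r hr η h0 h1 => ?_⟩
      have := key r hr
      rw [abs_of_nonneg h] at this
      have h3 : 0 ≤ (β - b / q) * r := by positivity
      rw [abs_le]; constructor <;> linarith
    · refine ⟨0, fun r hr η h0 h1 => ?_⟩
      have := key r hr
      rw [abs_of_nonpos h] at this
      have h3 : 0 ≤ -(β - b / q) * r := mul_nonneg (by linarith) (by positivity)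
      rw [abs_le]; constructor <;> linarith
  set n : ℤ := ⌊(x + c) * q⌋ with hn
  set y : ℝ := x + c - n / q with hy
  have hy0 : 0 ≤ y := by
    have := Int.floor_le ((x + c) * q)
    have : (n:ℝ) / q ≤ x + c := by rw [div_le_iff₀ hq']; exact this
    linarith
  have hy1 : y ≤ 1 / q := by
    have := Int.lt_floor_add_one ((x + c) * q)
    have : x + c ≤ ((n:ℝ) + 1) / q := by rw [le_div_iff₀ hq']; exact this.le
    have e : ((n:ℝ) + 1) / q = n / q + 1 / q := by ring
    linarith
  let κ : ℕ → ℕ := fun r => ((n + b * r) % (q : ℤ)).toNat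
  have hκ : ∀ r, ((κ r : ℕ) : ℤ) = (n + b * r) % (q : ℤ) := fun r =>
    Int.toNat_of_nonneg (Int.emod_nonneg _ hqz)
  have hκlt : ∀ r, κ r < q := by
    intro r
    have := Int.emod_lt_of_pos (n + b * r) (by exact_mod_cast hq : (0:ℤ) < q)
    rw [← hκ] at this
    exact_mod_cast this
  have hinj : Set.InjOn κ (Finset.range q : Set ℕ) := by
    intro r hr s hs hrs
    have hr' : r < q := by simpa using hr
    have hs' : s < q := by simpa using hs
    have h1 : (n + b * r) % (q : ℤ) = (n + b * s) % (q : ℤ) := by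
      rw [← hκ, ← hκ, hrs]
    have h2 : (q : ℤ) ∣ b * ((s : ℤ) - r) := by
      have := Int.ModEq.dvd h1
      have e : n + b * (s:ℤ) - (n + b * r) = b * ((s : ℤ) - r) := by ring
      rwa [e] at this
    have h3 : (q : ℤ) ∣ (s : ℤ) - r := by
      refine Int.dvd_of_dvd_mul_right_of_gcd_one h2 ?_
      rw [Int.gcd_comm]; exact hbq
    have h4 : (s : ℤ) - r = 0 := by
      apply Int.eq_zero_of_abs_lt_dvd h3
      rw [abs_lt]; constructor <;> omega
    omega
  have hpt : ∀ r ∈ Finset.range q,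
      auxh D L (x + β * r) ≤ auxf q D (κ r) + auxf q D (q - 1 - κ r) := by
    intro r hr
    have hr' : r < q := by simpa using hr
    apply csSup_le
    · exact Set.Nonempty.image _ ⟨x + β * r, by simp [hL0]⟩
    · rintro _ ⟨t, ht, rfl⟩
      have hp := hc r hr' (t - (x + β * r)) (by linarith [ht.1]) (by linarith [ht.2])
      have := aux_point q D hq hqD y _ (κ r) (hκlt r) hy0 hy1 hp
      refine le_trans (le_of_eq ?_) this
      have hdiv : ((n:ℝ) + b * r) = κ r + q * (((n + b * r) / (q:ℤ) : ℤ) : ℝ) := by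
        have := Int.emod_add_mul_ediv (n + b * r) (q:ℤ)
        rw [← hκ] at this
        exact_mod_cast this.symm
      have et : t = (y + κ r / q + ((β - b / q) * r + (t - (x + β * r)) - c))
          + (((n + b * r) / (q:ℤ) : ℤ) : ℝ) := by
        have : ((n:ℝ) + b * r) / q = κ r / q + (((n + b * r) / (q:ℤ) : ℤ) : ℝ) := by
          rw [hdiv]; field_simp
        have e2 : ((n:ℝ) + b * r) / q = n / q + b / q * r := by ring
        rw [hy]
        linarith
      show ‖F1 (Finset.range D) t‖ = _
      conv_lhs => rw [et]
      rw [aux_F1_add_int]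
  have hg : ∑ r ∈ Finset.range q, (auxf q D (κ r) + auxf q D (q - 1 - κ r))
      ≤ ∑ k ∈ Finset.range q, (auxf q D k + auxf q D (q - 1 - k)) := by
    rw [← Finset.sum_image (f := fun k => auxf q D k + auxf q D (q - 1 - k)) hinj]
    apply Finset.sum_le_sum_of_subset_of_nonneg
    · intro k hk
      obtain ⟨r, _, rfl⟩ := Finset.mem_image.mp hk
      exact Finset.mem_range.mpr (hκlt r)
    · intro k _ _
      exact add_nonneg (auxf_nonneg _ _ _) (auxf_nonneg _ _ _)
  have hs := auxf_sum q D
  have hr2 := Finset.sum_range_reflect (fun k => auxf q D k) q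
  have hr3 : ∑ k ∈ Finset.range q, (auxf q D k + auxf q D (q - 1 - k))
      = ∑ k ∈ Finset.range q, auxf q D k + ∑ k ∈ Finset.range q, auxf q D (q - 1 - k) :=
    Finset.sum_add_distrib
  have e : (q : ℝ) / D * (1 + Real.log q) = 2 * ((q : ℝ) / (2 * D) * (1 + Real.log q)) := by
    field_simp
  have := Finset.sum_le_sum hpt
  linarith

theorem aux_blocks (f : ℕ → ℝ) (q : ℕ) (C : ℝ)
    (h : ∀ s, ∑ r ∈ Finset.range q, f (s + r) ≤ C) (B : ℕ) :
    ∑ a ∈ Finset.range (B * q), f a ≤ B * C := by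
  induction B with
  | zero => simp
  | succ B ih =>
    rw [Nat.succ_mul, Finset.sum_range_add]
    have := h (B * q)
    push_cast
    linarith

/-- Upper bound on `G` under a Diophantine condition: with `A = {0,…,D-1}`
(so `max A + 1 = D`), `G ≤ 12 (D/M)(D/q + log q)`. -/
theorem stmt17 (M D : ℕ) (hD : 2 ≤ D) (hDM : D ^ 2 ≤ M) (α : ℚ) (hα1 : 1 ≤ α)
    (hα2 : α < (M : ℚ)) (b : ℤ) (q : ℕ) (hq0 : 0 < q) (hbq : Int.gcd b q = 1) (hqD : q ≤ D)
    (happ : |(α : ℝ) / (M : ℝ) - (b : ℝ) / (q : ℝ)| ≤ 1 / ((q : ℝ) * (D : ℝ))) :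
    Gquant M (Finset.range D) α ≤ 12 * ((D : ℝ) / (M : ℝ)) * ((D : ℝ) / (q : ℝ) + Real.log q) := by
  have hD' : (0:ℝ) < D := by exact_mod_cast (by omega : 0 < D)
  have hq' : (0:ℝ) < q := by exact_mod_cast hq0
  have hDM' : (D:ℝ) ^ 2 ≤ M := by exact_mod_cast hDM
  have hM' : (0:ℝ) < M := lt_of_lt_of_le (by positivity) hDM'
  have hα1' : (1:ℝ) ≤ α := by exact_mod_cast hα1
  have hα2' : (α:ℝ) < M := by exact_mod_cast hα2
  have hlq : 0 ≤ Real.log q := Real.log_natCast_nonneg q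
  have hsup : (((Finset.range D).sup id : ℕ) : ℝ) + 1 ≤ D := by
    have : (Finset.range D).sup id < D := by
      rw [Finset.sup_lt_iff (by simpa using (by omega : 0 < D))]
      intro k hk
      simpa using hk
    exact_mod_cast this
  unfold Gquant
  rw [Finset.card_range]
  obtain ⟨L, hLdef⟩ : ∃ L : ℝ, L = (α : ℝ) * (((Finset.range D).sup id : ℕ) + 1) / (M : ℝ) ^ 2 :=
    ⟨_, rfl⟩
  rw [← hLdef]
  have hL0 : 0 ≤ L := by rw [hLdef]; positivity
  have hL : L ≤ 1 / D := by
    rw [hLdef, div_le_div_iff₀ (by positivity) hD']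
    calc (α : ℝ) * (((Finset.range D).sup id : ℕ) + 1) * D ≤ M * D * D := by gcongr
      _ = M * (D:ℝ) ^ 2 := by ring
      _ ≤ M * M := by gcongr
      _ = 1 * (M:ℝ) ^ 2 := by ring
  have hmain : ∀ x : ℝ, ∑ a ∈ Finset.range D, auxh D L (x + (α : ℝ) * (a : ℝ) / (M : ℝ))
      ≤ 12 * ((D : ℝ) / (q : ℝ) + Real.log q) := by
    intro x
    set C : ℝ := 4 + (q : ℝ) / D * (1 + Real.log q) with hC
    have hC0 : 0 ≤ C := by positivity
    have h1 := aux_blocks (fun a => auxh D L (x + (α : ℝ) * (a : ℝ) / (M : ℝ))) q C (by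
      intro s
      have := aux_block q D hq0 hqD b hbq ((α : ℝ) / M) L hL0 hL happ (x + (α : ℝ) * s / M)
      refine le_trans (le_of_eq ?_) this
      apply Finset.sum_congr rfl
      intro r _
      congr 1
      push_cast
      ring) (D / q + 1)
    have h2 : ∑ a ∈ Finset.range D, auxh D L (x + (α : ℝ) * (a : ℝ) / (M : ℝ))
        ≤ ∑ a ∈ Finset.range ((D / q + 1) * q), auxh D L (x + (α : ℝ) * (a : ℝ) / (M : ℝ)) := by
      apply Finset.sum_le_sum_of_subset_of_nonneg
      · apply Finset.range_subset_range.mpr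
        have := Nat.lt_div_mul_add (a := D) hq0
        rw [Nat.succ_mul]
        omega
      · intro k _ _
        exact auxh_nonneg _ _ _
    have hone : (1:ℝ) ≤ (D:ℝ) / q := by
      rw [le_div_iff₀ hq', one_mul]; exact_mod_cast hqD
    have hB : (((D / q + 1 : ℕ)) : ℝ) ≤ 2 * ((D:ℝ) / q) := by
      have := @Nat.cast_div_le ℝ _ _ _ D q
      push_cast
      linarith
    have h3 : (((D / q + 1 : ℕ)) : ℝ) * C ≤ 2 * ((D:ℝ) / q) * C := by gcongr
    have h4 : 2 * ((D:ℝ) / q) * C = 8 * ((D:ℝ) / q) + 2 * (1 + Real.log q) := by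
      rw [hC]; field_simp; ring
    linarith
  have hS : sSup (Set.range fun x : ℝ => ∑ a ∈ Finset.range D,
      auxh D L (x + (α : ℝ) * (a : ℝ) / (M : ℝ))) ≤ 12 * ((D : ℝ) / (q : ℝ) + Real.log q) := by
    apply csSup_le (Set.range_nonempty _)
    rintro _ ⟨x, rfl⟩
    exact hmain x
  have := mul_le_mul_of_nonneg_left hS (by positivity : (0:ℝ) ≤ (D:ℝ) / M)
  refine le_trans this (le_of_eq ?_)
  ring

end
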